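/- Let S be a nonempty finite set (equipped with the discrete σ-algebra), let P : S → S → ℝ be a row-stochastic matrix with associated Markov kernel κ, and let T ⊆ S. Define ω : ℕ → S → ℝ by ω 0 s = 1 if s ∈ T and ω 0 s = 0 otherwise, and ω (n+1) s = 1 if s ∈ T and ω (n+1) s = Σ_{s' ∈ S} P s s' · ω n s' otherwise. Then for every s ∈ S, μ_s({ζ : ℕ → S | ∃ i, ζ i ∈ T}) = ⨆_{n ∈ ℕ} ω n s, where μ_s is the trajectory measure of the chain started at s; in particular the sequence n ↦ ω n s is monotone nondecreasing and converges to the probability of ever hitting T. -/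

import Mathlib

open MeasureTheory Finset Filter
open scoped ENNReal Classical Topology

/-- The bounded-reachability iterates: `omegaIter P T n s` is the probability that the
Markov chain with transition matrix `P` started at `s` visits `T` within `n` steps. -/
noncomputable def omegaIter {S : Type*} [Fintype S] (P : S → S → ℝ) (T : Set S) :
    ℕ → S → ℝ
  | 0, s => if s ∈ T then 1 else 0
  | n + 1, s => if s ∈ T then 1 else ∑ s' : S, P s s' * omegaIter P T n s'

lemma omegaIter_nonneg {S : Type*} [Fintype S] {P : S → S → ℝ} (hP0 : ∀ s s', 0 ≤ P s s')
    (T : Set S) (n : ℕ) (s : S) : 0 ≤ omegaIter P T n s := by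
  induction n generalizing s with
  | zero => rw [omegaIter]; positivity
  | succ n ih =>
    rw [omegaIter]
    split_ifs
    · exact zero_le_one
    · exact Finset.sum_nonneg fun s' _ => mul_nonneg (hP0 s s') (ih s')

lemma omegaIter_of_mem {S : Type*} [Fintype S] (P : S → S → ℝ) {T : Set S} {s : S} (hs : s ∈ T)
    (n : ℕ) : omegaIter P T n s = 1 := by
  cases n <;> simp [omegaIter, hs]

/-- Conditionally on the first `k + 1` coordinates, the probability of visiting `T` within the
next `n` steps is the `n`-th iterate at the current state. -/
lemma measure_cylinder_inter_reach {S : Type*} [Fintype S] [DecidableEq S]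
    [MeasurableSpace S] [MeasurableSingletonClass S]
    {P : S → S → ℝ} (hP0 : ∀ s s', 0 ≤ P s s') (T : Set S) {c : S → ℝ≥0∞}
    {ν : Measure (ℕ → S)}
    (hcyl : ∀ (n : ℕ) (a : ℕ → S),
      ν {ζ | ∀ i ≤ n, ζ i = a i} =
        c (a 0) * ∏ i ∈ Finset.range n, ENNReal.ofReal (P (a i) (a (i + 1))))
    (n k : ℕ) (a : ℕ → S) :
    ν {ζ | (∀ i ≤ k, ζ i = a i) ∧ ∃ j ≤ n, ζ (k + j) ∈ T} =
      ν {ζ | ∀ i ≤ k, ζ i = a i} * ENNReal.ofReal (omegaIter P T n (a k)) := by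
  have hmem (n k : ℕ) (a : ℕ → S) (hT : a k ∈ T) :
      ν {ζ | (∀ i ≤ k, ζ i = a i) ∧ ∃ j ≤ n, ζ (k + j) ∈ T} =
        ν {ζ | ∀ i ≤ k, ζ i = a i} * ENNReal.ofReal (omegaIter P T n (a k)) := by
    rw [omegaIter_of_mem P hT, ENNReal.ofReal_one, mul_one]
    congr 1 with ζ
    refine ⟨fun h => h.1, fun h => ⟨h, 0, n.zero_le, ?_⟩⟩
    simpa [h k le_rfl] using hT
  induction n generalizing k a with
  | zero =>
    by_cases hT : a k ∈ T
    · exact hmem _ k a hT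
    have hset : {ζ : ℕ → S | (∀ i ≤ k, ζ i = a i) ∧ ∃ j ≤ 0, ζ (k + j) ∈ T} = ∅ := by
      ext ζ
      simp only [Set.mem_ofPred_eq, Set.mem_empty_iff_false, iff_false]
      rintro ⟨h, j, hj, hζ⟩
      obtain rfl : j = 0 := by omega
      rw [add_zero, h k le_rfl] at hζ
      exact hT hζ
    rw [hset]
    simp [omegaIter, hT]
  | succ n ih =>
    by_cases hT : a k ∈ T
    · exact hmem _ k a hT
    have hset : {ζ : ℕ → S | (∀ i ≤ k, ζ i = a i) ∧ ∃ j ≤ n + 1, ζ (k + j) ∈ T} =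
        ⋃ s', {ζ | (∀ i ≤ k + 1, ζ i = Function.update a (k + 1) s' i) ∧
          ∃ j ≤ n, ζ (k + 1 + j) ∈ T} := by
      ext ζ
      simp only [Set.mem_ofPred_eq, Set.mem_iUnion]
      constructor
      · rintro ⟨h, j, hj, hζ⟩
        refine ⟨ζ (k + 1), fun i hi => ?_, ?_⟩
        · rcases eq_or_ne i (k + 1) with rfl | hne
          · simp
          · rw [Function.update_of_ne hne, h i (by omega)]
        · cases j with
          | zero => exact absurd (h k le_rfl ▸ hζ) hT
          | succ j => exact ⟨j, by omega, by rwa [add_assoc, add_comm 1 j]⟩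
      · rintro ⟨s', h, j, hj, hζ⟩
        refine ⟨fun i hi => ?_, j + 1, by omega, by rwa [add_comm j 1, ← add_assoc]⟩
        rw [h i (by omega), Function.update_of_ne (by omega)]
    have hdisj : Pairwise (Function.onFun Disjoint fun s' =>
        {ζ : ℕ → S | (∀ i ≤ k + 1, ζ i = Function.update a (k + 1) s' i) ∧
          ∃ j ≤ n, ζ (k + 1 + j) ∈ T}) := by
      intro s₁ s₂ hne
      refine Set.disjoint_left.2 fun ζ h₁ h₂ => hne ?_
      simpa using (h₁.1 (k + 1) le_rfl).symm.trans (h₂.1 (k + 1) le_rfl)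
    have hcyl_update (s' : S) : ν {ζ | ∀ i ≤ k + 1, ζ i = Function.update a (k + 1) s' i} =
        ν {ζ | ∀ i ≤ k, ζ i = a i} * ENNReal.ofReal (P (a k) s') := by
      have hprod : ∏ i ∈ Finset.range k, ENNReal.ofReal
          (P (Function.update a (k + 1) s' i) (Function.update a (k + 1) s' (i + 1))) =
            ∏ i ∈ Finset.range k, ENNReal.ofReal (P (a i) (a (i + 1))) := by
        refine Finset.prod_congr rfl fun i hi => ?_
        have := Finset.mem_range.1 hi
        rw [Function.update_of_ne (by omega), Function.update_of_ne (by omega)]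
      rw [hcyl, hcyl, Finset.prod_range_succ, hprod, Function.update_self,
        Function.update_of_ne (by omega), Function.update_of_ne (by omega), mul_assoc]
    have hstep (s' : S) : ν {ζ | (∀ i ≤ k + 1, ζ i = Function.update a (k + 1) s' i) ∧
        ∃ j ≤ n, ζ (k + 1 + j) ∈ T} =
          ν {ζ | ∀ i ≤ k, ζ i = a i} * ENNReal.ofReal (P (a k) s' * omegaIter P T n s') := by
      rw [ih, hcyl_update, Function.update_self, ENNReal.ofReal_mul (hP0 _ _), mul_assoc]
    rw [hset, measure_iUnion hdisj, tsum_fintype, omegaIter, if_neg hT,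
      ENNReal.ofReal_sum_of_nonneg fun s' _ => mul_nonneg (hP0 _ _) (omegaIter_nonneg hP0 T n s'),
      Finset.mul_sum]
    · exact Finset.sum_congr rfl fun s' _ => hstep s'
    · intro s'
      measurability

lemma measure_reach_within {S : Type*} [Fintype S] [DecidableEq S]
    [MeasurableSpace S] [MeasurableSingletonClass S]
    {P : S → S → ℝ} (hP0 : ∀ s s', 0 ≤ P s s') (T : Set S) {s : S}
    {ν : Measure (ℕ → S)} [IsProbabilityMeasure ν]
    (hcyl : ∀ (n : ℕ) (a : ℕ → S),
      ν {ζ | ∀ i ≤ n, ζ i = a i} =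
        (if a 0 = s then 1 else 0) *
          ∏ i ∈ Finset.range n, ENNReal.ofReal (P (a i) (a (i + 1))))
    (n : ℕ) :
    ν {ζ | ∃ j ≤ n, ζ j ∈ T} = ENNReal.ofReal (omegaIter P T n s) := by
  have hstart : ν {ζ | ∀ i ≤ 0, ζ i = s} = 1 := by simpa using hcyl 0 fun _ => s
  have hae : ∀ᵐ ζ ∂ν, ∀ i ≤ 0, ζ i = s := by
    rw [← prob_compl_eq_zero_iff] at hstart
    · exact hstart
    · measurability
  have h := measure_cylinder_inter_reach hP0 T (c := fun t => if t = s then 1 else 0) hcyl n 0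
    fun _ => s
  simp only [hstart, one_mul, zero_add] at h
  rw [← h]
  refine measure_congr (eventuallyEq_set.2 ?_)
  filter_upwards [hae] with ζ hζ
  exact ⟨fun hj => ⟨hζ, hj⟩, fun hj => hj.2⟩

/-- Final convergence step in the proof of Theorem 1: for a row-stochastic matrix `P` on
a nonempty finite set `S` (with the discrete σ-algebra) and the trajectory measures `μ s`
of the associated Markov chain started at `s` (characterized by their finite-dimensional
distributions `hcyl`, as given by the Ionescu–Tulcea construction applied to the kernel
`κ` with `κ s {s'} = P s s'`), the probability of ever hitting `T` equals the supremum of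
the bounded-reachability iterates; in particular `n ↦ omegaIter P T n s` is monotone
nondecreasing and converges to the probability of ever hitting `T`. -/
theorem prob_reach_eq_iSup {S : Type*} [Fintype S] [DecidableEq S] [Nonempty S]
    [MeasurableSpace S] [MeasurableSingletonClass S]
    (P : S → S → ℝ)
    (hP0 : ∀ s s', 0 ≤ P s s') (hP1 : ∀ s, ∑ s' : S, P s s' = 1)
    (T : Set S)
    (μ : S → Measure (ℕ → S))
    (hprob : ∀ s, IsProbabilityMeasure (μ s))
    (hcyl : ∀ (s : S) (n : ℕ) (a : ℕ → S),
      μ s {ζ | ∀ i ≤ n, ζ i = a i} =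
        (if a 0 = s then 1 else 0) *
          ∏ i ∈ Finset.range n, ENNReal.ofReal (P (a i) (a (i + 1)))) :
    ∀ s : S,
      μ s {ζ | ∃ i : ℕ, ζ i ∈ T} = ⨆ n : ℕ, ENNReal.ofReal (omegaIter P T n s) ∧
      Monotone (fun n => omegaIter P T n s) ∧
      Tendsto (fun n => omegaIter P T n s) atTop
        (𝓝 ((μ s {ζ | ∃ i : ℕ, ζ i ∈ T}).toReal)) := by
  intro s
  have := hprob s
  have hreach := measure_reach_within hP0 T (hcyl s)
  have hmono_sets : Monotone fun n : ℕ => {ζ : ℕ → S | ∃ j ≤ n, ζ j ∈ T} :=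
    fun m n hmn ζ ⟨j, hj, hζ⟩ => ⟨j, hj.trans hmn, hζ⟩
  have hunion : {ζ : ℕ → S | ∃ i, ζ i ∈ T} = ⋃ n, {ζ | ∃ j ≤ n, ζ j ∈ T} := by
    ext ζ
    simp only [Set.mem_ofPred_eq, Set.mem_iUnion]
    exact ⟨fun ⟨i, hi⟩ => ⟨i, i, le_rfl, hi⟩, fun ⟨_, i, _, hi⟩ => ⟨i, hi⟩⟩
  refine ⟨?_, fun m n hmn => ?_, ?_⟩
  · rw [hunion, hmono_sets.measure_iUnion]
    exact iSup_congr hreach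
  · refine (ENNReal.ofReal_le_ofReal_iff (omegaIter_nonneg hP0 T n s)).1 ?_
    rw [← hreach, ← hreach]
    exact measure_mono (hmono_sets hmn)
  · have hlim := (ENNReal.tendsto_toReal (measure_ne_top (μ s) _)).comp
      (tendsto_measure_iUnion_atTop (μ := μ s) hmono_sets)
    rw [hunion]
    refine hlim.congr fun n => ?_
    simp only [Function.comp_apply, hreach, ENNReal.toReal_ofReal (omegaIter_nonneg hP0 T n s)]
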